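/- Let ABC be a triangle with incenter I and incircle 𝓘 of radius r. Under the inversion with center I and power r², the images of the three Apollonius circles of triangle ABC are the three Apollonius circles of the image triangle A₁B₁C₁ (the medial triangle of the contact triangle); consequently the images are coaxal and the circumcenter O₁ of A₁B₁C₁ lies on their common radical axis, the Brocard axis of triangle A₁B₁C₁. -/

import Mathlib

open EuclideanGeometry RealInnerProductSpace Real

noncomputable section

/-- The Euclidean plane. -/
abbrev Pt := EuclideanSpace ℝ (Fin 2)

/-- The point with homogeneous barycentric coordinates `(x : y : z)` with respect to `A B C`. -/
def bary (A B C : Pt) (x y z : ℝ) : Pt := (x + y + z)⁻¹ • (x • A + y • B + z • C)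

/-- The incenter of triangle `ABC`, with barycentric coordinates `(a : b : c)`. -/
def incenterPt (A B C : Pt) : Pt := bary A B C (dist B C) (dist C A) (dist A B)

/-- The centroid of triangle `ABC`. -/
def centroidPt (A B C : Pt) : Pt := bary A B C 1 1 1

/-- The power of a point `p` with respect to a circle `s`. -/
def spow (s : Sphere Pt) (p : Pt) : ℝ := dist p s.center ^ 2 - s.radius ^ 2

/-- The radical axis of two circles: the locus of points of equal power. -/
def radAxis (s t : Sphere Pt) : Set Pt := {p | spow s p = spow t p}

/-- Three circles are coaxal if the radical axes of all pairs coincide. -/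
def Coaxal (s t u : Sphere Pt) : Prop := radAxis s t = radAxis t u ∧ radAxis t u = radAxis s u

/-- The isogonal-conjugate image (with respect to triangle `ABC`) of a set `L`:
for `L` a line this is the circumconic that is the isogonal conjugate of `L`. -/
def isogSet (A B C : Pt) (L : Set Pt) : Set Pt :=
  {S | ∃ p q r : ℝ, p ≠ 0 ∧ q ≠ 0 ∧ r ≠ 0 ∧ p + q + r ≠ 0 ∧
    dist B C ^ 2 / p + dist C A ^ 2 / q + dist A B ^ 2 / r ≠ 0 ∧
    bary A B C p q r ∈ L ∧
    S = bary A B C (dist B C ^ 2 / p) (dist C A ^ 2 / q) (dist A B ^ 2 / r)}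

/-- Direction of the internal bisector of the angle at `A` in triangle `ABC`
(sum of the unit vectors toward the other two vertices). -/
def intBisDir (A B C : Pt) : Pt := (dist A B)⁻¹ • (B - A) + (dist A C)⁻¹ • (C - A)

/-- A circle is tangent to a line: they touch at a point and the line does not
enter the interior of the circle. -/
def TangentLine (s : Sphere Pt) (L : AffineSubspace ℝ Pt) : Prop :=
  ∃ p, p ∈ L ∧ p ∈ s ∧ ∀ q ∈ L, s.radius ≤ dist s.center q

/-- Two circles are tangent at a point `p`: `p` lies on both and is collinear with the centers. -/
def TangentAt (s t : Sphere Pt) (p : Pt) : Prop :=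
  p ∈ s ∧ p ∈ t ∧ Collinear ℝ ({s.center, t.center, p} : Set Pt)

/-- The tripolar (trilinear polar) of the point with barycentrics `(u : v : w)`,
as the set of points with barycentrics `(x:y:z)` satisfying `x/u + y/v + z/w = 0`. -/
def tripolarSet (A B C : Pt) (u v w : ℝ) : Set Pt :=
  {S | ∃ x y z : ℝ, x + y + z ≠ 0 ∧ S = bary A B C x y z ∧ x / u + y / v + z / w = 0}

/-- `(P, Q; R, S) = -1`: the four collinear points form a harmonic range. -/
def Harmonic (P Q R S : Pt) : Prop := ∃ k : ℝ, P - R = k • (Q - R) ∧ P - S = -k • (Q - S)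

lemma dist_sq_coord (p q : Pt) : dist p q ^ 2 = (p 0 - q 0) ^ 2 + (p 1 - q 1) ^ 2 := by
  rw [EuclideanSpace.dist_eq, Real.sq_sqrt (by positivity), Fin.sum_univ_two,
    Real.dist_eq, Real.dist_eq, sq_abs, sq_abs]

lemma inner_coord (p q : Pt) : ⟪p, q⟫ = p 0 * q 0 + p 1 * q 1 := by
  simp [PiLp.inner_apply, Fin.sum_univ_two, mul_comm]

lemma mem_sphere_iff_sq {s : Sphere Pt} (hs : 0 ≤ s.radius) (p : Pt) :
    p ∈ s ↔ (p 0 - s.center 0) ^ 2 + (p 1 - s.center 1) ^ 2 = s.radius ^ 2 := by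
  rw [EuclideanGeometry.mem_sphere, ← dist_sq_coord, sq_eq_sq₀ dist_nonneg hs]

/-- Two circles with the same points are equal, provided one has positive radius. -/
lemma sphere_eq_of_mem_iff {s t : Sphere Pt} (ht : 0 < t.radius)
    (h : ∀ p, p ∈ s ↔ p ∈ t) : s = t := by
  have hmem : ∀ k : ℝ × ℝ, k.1 ^ 2 + k.2 ^ 2 = t.radius ^ 2 →
      t.center + !₂[k.1, k.2] ∈ s := fun k hk => by
    rw [h, mem_sphere_iff_sq ht.le]
    simpa using hk
  have hs : 0 ≤ s.radius := Sphere.radius_nonneg_of_mem (hmem (t.radius, 0) (by simp))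
  have hc : s.center = t.center := by
    by_contra hne
    set L := dist s.center t.center with hL
    have hLpos : 0 < L := dist_pos.2 hne
    have hL2 : L ^ 2 = _ := dist_sq_coord s.center t.center
    set d₀ := s.center 0 - t.center 0 with hd₀
    set d₁ := s.center 1 - t.center 1 with hd₁
    have hk : (t.radius / L * d₀) ^ 2 + (t.radius / L * d₁) ^ 2 = t.radius ^ 2 := by
      field_simp
      linear_combination -hL2
    have h₁ := hmem (t.radius / L * d₀, t.radius / L * d₁) hk
    have h₂ := hmem (-(t.radius / L * d₀), -(t.radius / L * d₁)) (by simpa using hk)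
    rw [mem_sphere_iff_sq hs] at h₁ h₂
    simp only [PiLp.add_apply, Matrix.cons_val_zero, Matrix.cons_val_one] at h₁ h₂
    have h₃ : t.radius / L * (d₀ ^ 2 + d₁ ^ 2) = 0 := by
      rw [hd₀, hd₁] at *
      linear_combination (h₂ - h₁) / 4
    rw [← hL2] at h₃
    have : 0 < t.radius / L * L ^ 2 := by positivity
    linarith
  have hmem₀ := hmem (t.radius, 0) (by simp)
  have hmem₁ := (h _).1 hmem₀
  rw [EuclideanGeometry.mem_sphere] at hmem₀ hmem₁
  rw [hc] at hmem₀
  exact EuclideanGeometry.Sphere.ext hc (hmem₀.symm.trans hmem₁)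

/-- A circle that is the locus of points with ratio of distances `γ / β` to two distinct points:
the ratio is not `1`, and the power of a point is an explicit combination of the distances. -/
lemma spow_of_ratio_locus {s : Sphere Pt} {B C : Pt} {β γ : ℝ} (hBC : B ≠ C) (hβ : 0 < β)
    (hγ : 0 < γ) (h : ∀ p : Pt, p ∈ s ↔ dist p B * β = dist p C * γ) :
    β ^ 2 - γ ^ 2 ≠ 0 ∧
      ∀ p, (β ^ 2 - γ ^ 2) * spow s p = β ^ 2 * dist p B ^ 2 - γ ^ 2 * dist p C ^ 2 := by
  have hpos : 0 < dist B C := dist_pos.2 hBC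
  have hd := dist_sq_coord B C
  have h' : ∀ p : Pt, p ∈ s ↔
      ((p 0 - B 0) ^ 2 + (p 1 - B 1) ^ 2) * β ^ 2 = ((p 0 - C 0) ^ 2 + (p 1 - C 1) ^ 2) * γ ^ 2 := by
    intro p
    rw [h, ← sq_eq_sq₀ (by positivity) (by positivity), mul_pow, mul_pow, dist_sq_coord,
      dist_sq_coord]
  have hne : β ^ 2 - γ ^ 2 ≠ 0 := by
    intro h0
    have hβγ : β ^ 2 = γ ^ 2 := sub_eq_zero.1 h0
    have hmem : ∀ k : ℝ, !₂[(B 0 + C 0) / 2 + k * (C 1 - B 1),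
        (B 1 + C 1) / 2 - k * (C 0 - B 0)] ∈ s := fun k => by
      rw [h', hβγ]
      simp
      left
      ring
    have hs : 0 ≤ s.radius := Sphere.radius_nonneg_of_mem (hmem 0)
    have h₀ := hmem 0
    have h₁ := hmem 1
    have h₂ := hmem (-1)
    rw [mem_sphere_iff_sq hs] at h₀ h₁ h₂
    simp at h₀ h₁ h₂
    have : dist B C ^ 2 = 0 := by
      rw [hd]
      linear_combination h₁ / 2 + h₂ / 2 - h₀
    nlinarith
  refine ⟨hne, fun p => ?_⟩
  set δ := β ^ 2 - γ ^ 2 with hδ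
  let t : Sphere Pt := ⟨δ⁻¹ • (β ^ 2 • B - γ ^ 2 • C), β * γ * dist B C / |δ|⟩
  have hδ' : 0 < |δ| := abs_pos.2 hne
  have htr : 0 < t.radius := by
    change 0 < β * γ * dist B C / |δ|
    positivity
  have key : ∀ p, δ * spow t p = β ^ 2 * dist p B ^ 2 - γ ^ 2 * dist p C ^ 2 := by
    intro p
    simp only [spow, t, div_pow, mul_pow, sq_abs, dist_sq_coord]
    simp
    field_simp
    rw [hδ]
    ring
  have hst : s = t := by
    refine sphere_eq_of_mem_iff htr fun p => ?_
    rw [h', EuclideanGeometry.mem_sphere, ← sq_eq_sq₀ dist_nonneg htr.le, ← sub_eq_zero (b := _ ^ 2)]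
    change _ ↔ spow t p = 0
    have := key p
    rw [← dist_sq_coord, ← dist_sq_coord, mul_comm (dist p B ^ 2), mul_comm (dist p C ^ 2),
      ← sub_eq_zero, ← this,
      mul_eq_zero, or_iff_right hne]
  rw [hst, key]

lemma exists_smul_of_inner_eq_zero {n v w : Pt} (hn : n ≠ 0) (hw : w ≠ 0) (hwn : ⟪w, n⟫ = 0)
    (hvn : ⟪v, n⟫ = 0) : ∃ k : ℝ, v = k • w := by
  rw [inner_coord] at hwn hvn
  have hw2 : w 0 ^ 2 + w 1 ^ 2 ≠ 0 := fun h => hw <| by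
    ext i; fin_cases i <;> simp <;> nlinarith
  have hcross : v 0 * w 1 - v 1 * w 0 = 0 := by
    by_contra hc
    refine hn ?_
    have h₀ : n 0 = 0 :=
      (mul_eq_zero.1 (by linear_combination w 1 * hvn - v 1 * hwn)).resolve_left hc
    have h₁ : n 1 = 0 :=
      (mul_eq_zero.1 (by linear_combination v 0 * hwn - w 0 * hvn)).resolve_left hc
    ext i
    fin_cases i
    · exact h₀
    · exact h₁
  refine ⟨(v 0 * w 0 + v 1 * w 1) / (w 0 ^ 2 + w 1 ^ 2), ?_⟩
  ext i
  fin_cases i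
  · simp
    field_simp
    linear_combination w 1 * hcross
  · simp
    field_simp
    linear_combination -w 0 * hcross

/-- The Brocard axis of a non-equilateral triangle, as a locus. -/
lemma brocard_axis_locus {A B C O K : Pt} (hABC : AffineIndependent ℝ ![A, B, C])
    {α β γ : ℝ} (hα : α = dist B C ^ 2) (hβ : β = dist C A ^ 2) (hγ : γ = dist A B ^ 2)
    (hα0 : 0 < α) (hβ0 : 0 < β) (hγ0 : 0 < γ) (hβγ : β - γ ≠ 0)
    (hO₁ : dist O A = dist O B) (hO₂ : dist O B = dist O C) (hK : K = bary A B C α β γ) :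
    {p : Pt | α * (β - γ) * dist p A ^ 2 + β * (γ - α) * dist p B ^ 2
      + γ * (α - β) * dist p C ^ 2 = 0} = (line[ℝ, O, K] : Set Pt) := by
  have hσ : α + β + γ ≠ 0 := by positivity
  have h₁ : dist O A ^ 2 = dist O B ^ 2 := by rw [hO₁]
  have h₂ : dist O B ^ 2 = dist O C ^ 2 := by rw [hO₂]
  rw [dist_sq_coord, dist_sq_coord] at h₁ h₂
  rw [dist_sq_coord] at hα hβ hγ
  set n : Pt := (α * (β - γ)) • A + (β * (γ - α)) • B + (γ * (α - β)) • C with hn_def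
  have hn : n ≠ 0 := by
    intro h0
    have := (affineIndependent_iff.1 hABC) Finset.univ
      ![α * (β - γ), β * (γ - α), γ * (α - β)] (by simp [Fin.sum_univ_three]; ring)
      (by simpa [Fin.sum_univ_three] using h0) 0 (Finset.mem_univ _)
    simp at this
    rcases this with h | h
    · exact hα0.ne' h
    · exact hβγ h
  have hK' : ∀ i, (α + β + γ) * (K i - O i)
      = α * (A i - O i) + β * (B i - O i) + γ * (C i - O i) := by
    intro i
    rw [hK]
    simp [bary]
    field_simp
    ring
  have hlocus : ∀ p : Pt, α * (β - γ) * dist p A ^ 2 + β * (γ - α) * dist p B ^ 2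
      + γ * (α - β) * dist p C ^ 2 = -2 * ⟪p - O, n⟫ := by
    intro p
    rw [inner_coord]
    simp only [dist_sq_coord, hn_def]
    simp
    linear_combination (α * (β - γ)) * h₁ - γ * (α - β) * h₂
  set ρ := (O 0 - A 0) ^ 2 + (O 1 - A 1) ^ 2 with hρ
  have hbc : (B 0 - O 0) * (C 0 - O 0) + (B 1 - O 1) * (C 1 - O 1) = ρ - α / 2 := by
    linear_combination hα / 2 - h₁ - h₂ / 2
  have hca : (C 0 - O 0) * (A 0 - O 0) + (C 1 - O 1) * (A 1 - O 1) = ρ - β / 2 := by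
    linear_combination hβ / 2 - h₁ / 2 - h₂ / 2
  have hab : (A 0 - O 0) * (B 0 - O 0) + (A 1 - O 1) * (B 1 - O 1) = ρ - γ / 2 := by
    linear_combination hγ / 2 - h₁ / 2
  have hKO : K - O ≠ 0 := by
    intro h0
    have e : ∀ i, K i - O i = 0 := fun i => by simpa using congrArg (fun x : Pt => x i) h0
    have e0 := hK' 0
    have e1 := hK' 1
    rw [e, mul_zero] at e0 e1
    have f₂ : α * (ρ - γ / 2) + β * ρ + γ * (ρ - α / 2) = 0 := by
      linear_combination -α * hab - γ * hbc - (B 0 - O 0) * e0 - (B 1 - O 1) * e1 + β * h₁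
    have f₃ : α * (ρ - β / 2) + β * (ρ - α / 2) + γ * ρ = 0 := by
      linear_combination -α * hca - β * hbc - (C 0 - O 0) * e0 - (C 1 - O 1) * e1
        + γ * h₁ + γ * h₂
    have : α * (β - γ) = 0 := by linear_combination f₂ - f₃
    rcases mul_eq_zero.1 this with h | h
    · exact hα0.ne' h
    · exact hβγ h
  have hKn : ⟪K - O, n⟫ = 0 := by
    refine (mul_right_inj' hσ).1 ?_
    rw [inner_coord, mul_zero]
    have hn' : ∀ i, n i = α * (β - γ) * (A i - O i) + β * (γ - α) * (B i - O i)
        + γ * (α - β) * (C i - O i) := fun i => by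
      simp [hn_def]; ring
    have : (α + β + γ) * ((K - O) 0 * n 0 + (K - O) 1 * n 1)
        = ((α + β + γ) * (K 0 - O 0)) * n 0 + ((α + β + γ) * (K 1 - O 1)) * n 1 := by
      simp; ring
    rw [this, hK', hK', hn', hn']
    linear_combination (α * β * (β - α)) * hab + (β * γ * (γ - β)) * hbc
      + (γ * α * (α - γ)) * hca - β ^ 2 * (γ - α) * h₁ - γ ^ 2 * (α - β) * (h₁ + h₂)
  ext p
  simp only [Set.mem_ofPred_eq, SetLike.mem_coe]
  rw [hlocus]
  constructor
  · intro h
    obtain ⟨k, hk⟩ := exists_smul_of_inner_eq_zero hn hKO hKn (v := p - O) (by linarith)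
    have := AffineMap.lineMap_mem_affineSpan_pair k O K
    rwa [AffineMap.lineMap_apply, vsub_eq_sub, ← hk, vadd_eq_add, sub_add_cancel] at this
  · intro h
    obtain ⟨k, rfl⟩ := mem_affineSpan_pair_iff_exists_lineMap_eq.1 h
    rw [AffineMap.lineMap_apply, vsub_eq_sub, vadd_eq_add, add_sub_cancel_right,
      real_inner_smul_left, hKn]
    simp

lemma incenterPt_rotate (A B C : Pt) : incenterPt B C A = incenterPt A B C := by
  ext i
  simp only [incenterPt, bary, PiLp.smul_apply, PiLp.add_apply]
  rw [show dist C A + dist A B + dist B C = dist B C + dist C A + dist A B by ring]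
  simp only [smul_eq_mul]
  ring

lemma incenterPt_coord {A B C : Pt} (hBC : B ≠ C) (i : Fin 2) :
    incenterPt A B C i = A i + (dist C A * (B i - A i) + dist A B * (C i - A i))
      / (dist B C + dist C A + dist A B) := by
  have : 0 < dist B C := dist_pos.2 hBC
  have : 0 < dist B C + dist C A + dist A B := by positivity
  simp [incenterPt, bary]
  field_simp
  ring

lemma inner_sides (A B C : Pt) :
    2 * ((B 0 - A 0) * (C 0 - A 0) + (B 1 - A 1) * (C 1 - A 1))
      = dist C A ^ 2 + dist A B ^ 2 - dist B C ^ 2 := by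
  rw [dist_sq_coord, dist_sq_coord, dist_sq_coord]
  ring

/-- The foot of the perpendicular from the incenter to the side `CA`. -/
lemma contact_point_coord {A B C I E : Pt} (hCA : C ≠ A) (hBC : B ≠ C) (hI : I = incenterPt A B C)
    (hE₁ : E ∈ line[ℝ, C, A]) (hE₂ : ⟪E - I, A - C⟫ = 0) (i : Fin 2) :
    E i = A i + (dist C A + dist A B - dist B C) / (2 * dist C A) * (C i - A i) := by
  obtain ⟨k, rfl⟩ := mem_affineSpan_pair_iff_exists_lineMap_eq.1 hE₁
  have hb : 0 < dist C A := dist_pos.2 hCA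
  have ha : 0 < dist B C := dist_pos.2 hBC
  have hc : 0 ≤ dist A B := dist_nonneg
  have hb2 := dist_sq_coord C A
  have huv := inner_sides A B C
  have hI' := incenterPt_coord (A := A) hBC
  rw [← hI] at hI'
  rw [inner_coord, AffineMap.lineMap_apply] at hE₂
  simp only [vsub_eq_sub, vadd_eq_add, PiLp.sub_apply, PiLp.add_apply, PiLp.smul_apply,
    smul_eq_mul, hI'] at hE₂
  rw [AffineMap.lineMap_apply]
  simp only [vsub_eq_sub, vadd_eq_add, PiLp.sub_apply, PiLp.add_apply, PiLp.smul_apply,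
    smul_eq_mul]
  generalize dist C A = b at *
  generalize dist A B = c at *
  generalize dist B C = a at *
  have hs : 0 < a + b + c := by positivity
  have hk : 2 * b * (1 - k) = b + c - a := by
    have hbs : b * (a + b + c) ≠ 0 := by positivity
    refine mul_left_cancel₀ hbs ?_
    field_simp at hE₂
    linear_combination -2 * hE₂ + (2 * (a + b + c) * (1 - k) - 2 * c) * hb2 + b * huv
  have : (b + c - a) / (2 * b) = 1 - k := by
    rw [← hk]; field_simp
  rw [this]
  ring

/-- The inradius of a triangle in terms of its sides. -/
lemma dist_incenter_contact_sq {A B C I E : Pt} (hCA : C ≠ A) (hBC : B ≠ C)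
    (hI : I = incenterPt A B C) (hE₁ : E ∈ line[ℝ, C, A]) (hE₂ : ⟪E - I, A - C⟫ = 0) :
    dist I E ^ 2 = (dist C A + dist A B - dist B C) * (dist A B + dist B C - dist C A)
      * (dist B C + dist C A - dist A B) / (4 * (dist B C + dist C A + dist A B)) := by
  have hb : 0 < dist C A := dist_pos.2 hCA
  have ha : 0 < dist B C := dist_pos.2 hBC
  have hc : 0 ≤ dist A B := dist_nonneg
  have hb2 := dist_sq_coord C A
  have hc2 := dist_sq_coord A B
  have huv := inner_sides A B C
  rw [dist_sq_coord, contact_point_coord hCA hBC hI hE₁ hE₂,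
    contact_point_coord hCA hBC hI hE₁ hE₂, hI, incenterPt_coord hBC, incenterPt_coord hBC]
  generalize dist C A = b at *
  generalize dist A B = c at *
  generalize dist B C = a at *
  have hs : 0 < a + b + c := by positivity
  set x := (b + c - a) / (2 * b) with hx
  set y := b / (a + b + c) with hy
  set z := c / (a + b + c) with hz
  have h : ∀ i : Fin 2, A i + (b * (B i - A i) + c * (C i - A i)) / (a + b + c)
      - (A i + x * (C i - A i)) = y * (B i - A i) + (z - x) * (C i - A i) := fun i => by
    rw [hy, hz]
    field_simp
    ring
  rw [h, h]
  have : y ^ 2 * c ^ 2 + (z - x) ^ 2 * b ^ 2 + y * (z - x) * (b ^ 2 + c ^ 2 - a ^ 2)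
      = (b + c - a) * (c + a - b) * (a + b - c) / (4 * (a + b + c)) := by
    rw [hx, hy, hz]
    field_simp
    ring
  rw [← this]
  linear_combination -y ^ 2 * hc2 - (z - x) ^ 2 * hb2 + y * (z - x) * huv

lemma dist_incenter_vertex_sq {A B C I : Pt} (hBC : B ≠ C) (hI : I = incenterPt A B C) :
    dist A I ^ 2 = dist C A * dist A B * (dist C A + dist A B - dist B C)
      / (dist B C + dist C A + dist A B) := by
  have ha : 0 < dist B C := dist_pos.2 hBC
  have hb : 0 ≤ dist C A := dist_nonneg
  have hc : 0 ≤ dist A B := dist_nonneg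
  have hb2 := dist_sq_coord C A
  have hc2 := dist_sq_coord A B
  have huv := inner_sides A B C
  rw [dist_sq_coord, hI, incenterPt_coord hBC, incenterPt_coord hBC]
  generalize dist C A = b at *
  generalize dist A B = c at *
  generalize dist B C = a at *
  have hs : 0 < a + b + c := by positivity
  field_simp
  linear_combination -b ^ 2 * hc2 - c ^ 2 * hb2 + b * c * huv

/-- The midpoint of the segment joining the contact points on the sides through `A` is the
inverse of `A` in the incircle. -/
lemma midpoint_contact_eq_inversion {A B C I E F : Pt} {r : ℝ} (hBC : B ≠ C) (hCA : C ≠ A)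
    (hAB : A ≠ B) (ht : 0 < dist C A + dist A B - dist B C) (hI : I = incenterPt A B C)
    (hE₁ : E ∈ line[ℝ, C, A]) (hE₂ : ⟪E - I, A - C⟫ = 0)
    (hF₁ : F ∈ line[ℝ, A, B]) (hF₂ : ⟪F - I, B - A⟫ = 0) (hr : r ^ 2 = dist I E ^ 2) :
    midpoint ℝ E F = EuclideanGeometry.inversion I r A := by
  have hb : 0 < dist C A := dist_pos.2 hCA
  have ha : 0 < dist B C := dist_pos.2 hBC
  have hc : 0 < dist A B := dist_pos.2 hAB
  have hE := contact_point_coord hCA hBC hI hE₁ hE₂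
  have hF := contact_point_coord hAB hCA (hI.trans (incenterPt_rotate A B C).symm) hF₁ hF₂
  have hq : (r / dist A I) ^ 2 = (dist A B + dist B C - dist C A)
      * (dist B C + dist C A - dist A B) / (4 * dist C A * dist A B) := by
    rw [div_pow, hr, dist_incenter_contact_sq hCA hBC hI hE₁ hE₂, dist_incenter_vertex_sq hBC hI]
    generalize dist C A = b at *
    generalize dist A B = c at *
    generalize dist B C = a at *
    field_simp
  ext i
  rw [EuclideanGeometry.inversion, hq, midpoint_eq_smul_add]
  simp only [vsub_eq_sub, vadd_eq_add, PiLp.sub_apply, PiLp.add_apply, PiLp.smul_apply,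
    smul_eq_mul, hE, hF, hI, incenterPt_coord hBC, invOf_eq_inv]
  generalize dist C A = b at *
  generalize dist A B = c at *
  generalize dist B C = a at *
  field_simp
  ring

lemma dist_lt_of_affineIndependent {A B C : Pt} (h : AffineIndependent ℝ ![A, B, C]) :
    dist B C < dist C A + dist A B := by
  rw [affineIndependent_iff_not_collinear_set] at h
  refine lt_of_le_of_ne ?_ fun heq => h ?_
  · have := dist_triangle B A C
    rw [dist_comm B A, dist_comm A C] at this
    linarith
  · have : Wbtw ℝ B A C := dist_add_dist_eq_iff.1 (by
      rw [dist_comm B A, dist_comm A C]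
      linarith)
    rw [Set.insert_comm]
    exact this.collinear

/-- An inversion maps an Apollonius circle of a triangle to an Apollonius circle of the image
triangle. -/
lemma inversion_image_apollonius {A B C I : Pt} {r : ℝ} (hr : r ≠ 0) (hAI : A ≠ I) (hBI : B ≠ I)
    (hCI : C ≠ I) (hAB : A ≠ B) (hBC : B ≠ C) (hCA : C ≠ A) {A₁ B₁ C₁ : Pt}
    (hA₁ : A₁ = EuclideanGeometry.inversion I r A) (hB₁ : B₁ = EuclideanGeometry.inversion I r B)
    (hC₁ : C₁ = EuclideanGeometry.inversion I r C) {s s₁ : Sphere Pt}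
    (hs : ∀ p : Pt, p ∈ s ↔ dist p B * dist A C = dist p C * dist A B)
    (hs₁ : ∀ p : Pt, p ∈ s₁ ↔ dist p B₁ * dist A₁ C₁ = dist p C₁ * dist A₁ B₁) :
    EuclideanGeometry.inversion I r '' {p : Pt | p ∈ s} = {p : Pt | p ∈ s₁} := by
  have hA := dist_pos.2 hAI
  have hB := dist_pos.2 hBI
  have hC := dist_pos.2 hCI
  have hr2 : 0 < r ^ 2 := by positivity
  have dAB : dist A₁ B₁ = r ^ 2 / (dist A I * dist B I) * dist A B := by
    rw [hA₁, hB₁, EuclideanGeometry.dist_inversion_inversion hAI hBI]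
  have dAC : dist A₁ C₁ = r ^ 2 / (dist A I * dist C I) * dist A C := by
    rw [hA₁, hC₁, EuclideanGeometry.dist_inversion_inversion hAI hCI]
  have dBI : dist I B₁ = r ^ 2 / dist B I := by
    rw [hB₁, EuclideanGeometry.dist_center_inversion, dist_comm I B]
  have dCI : dist I C₁ = r ^ 2 / dist C I := by
    rw [hC₁, EuclideanGeometry.dist_center_inversion, dist_comm I C]
  have hinj := EuclideanGeometry.inversion_injective I hr
  have hB₁C₁ : B₁ ≠ C₁ := by
    rw [hB₁, hC₁]
    exact hinj.ne hBC
  have hAB' := dist_pos.2 hAB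
  have hAC' := dist_pos.2 hCA.symm
  have hI : I ∉ s := fun h => by
    have h' := (hs I).1 h
    rw [dist_comm I B, dist_comm I C] at h'
    refine (spow_of_ratio_locus hB₁C₁ (by rw [dAC]; positivity) (by rw [dAB]; positivity) hs₁).1 ?_
    rw [dAC, dAB, sub_eq_zero]
    congr 1
    field_simp
    linear_combination h'
  have hI₁ : I ∉ s₁ := fun h => by
    have h' := (hs₁ I).1 h
    rw [dBI, dCI, dAC, dAB] at h'
    refine (spow_of_ratio_locus hBC hAC' hAB' hs).1 ?_
    rw [sub_eq_zero]
    congr 1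
    field_simp at h'
    linear_combination h'
  have key : ∀ p, EuclideanGeometry.inversion I r p ∈ s₁ ↔ p ∈ s := by
    intro p
    rcases eq_or_ne p I with rfl | hp
    · rw [EuclideanGeometry.inversion_self]
      exact iff_of_false hI₁ hI
    · have hp' := dist_pos.2 hp
      rw [hs₁, hs, dAC, dAB, hB₁, hC₁, EuclideanGeometry.dist_inversion_inversion hp hBI,
        EuclideanGeometry.dist_inversion_inversion hp hCI]
      field_simp
  ext p
  constructor
  · rintro ⟨q, hq, rfl⟩
    exact (key q).2 hq
  · intro hp
    refine ⟨EuclideanGeometry.inversion I r p, ?_, EuclideanGeometry.inversion_inversion I hr p⟩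
    refine (key _).1 ?_
    rwa [EuclideanGeometry.inversion_inversion I hr p]

lemma radAxis_comm (s t : Sphere Pt) : radAxis s t = radAxis t s :=
  Set.ext fun _ => eq_comm

/-- The radical axis of two Apollonius circles, as a locus. -/
lemma mem_radAxis_iff_of_spow {s t : Sphere Pt} {α β γ : ℝ} {p : Pt} {x y z : ℝ}
    (hs₀ : β - γ ≠ 0) (ht₀ : γ - α ≠ 0) (hs : (β - γ) * spow s p = β * y - γ * z)
    (ht : (γ - α) * spow t p = γ * z - α * x) :
    p ∈ radAxis s t ↔ α * (β - γ) * x + β * (γ - α) * y + γ * (α - β) * z = 0 := by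
  have h : (β - γ) * (γ - α) * (spow s p - spow t p)
      = α * (β - γ) * x + β * (γ - α) * y + γ * (α - β) * z := by
    linear_combination (γ - α) * hs - (β - γ) * ht
  rw [← h, mul_eq_zero, or_iff_right (mul_ne_zero hs₀ ht₀), sub_eq_zero]
  rfl

/-- Under the inversion with center `I` and power `r²`, the images of the three
Apollonius circles of `ABC` are the three Apollonius circles of the inverted triangle
`A₁B₁C₁`; these are coaxal and the circumcenter `O₁` of `A₁B₁C₁` lies on their common radical
axis, the Brocard axis `O₁K₁` of `A₁B₁C₁`. -/
theorem stmt_19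
    (A B C : Pt) (hABC : AffineIndependent ℝ ![A, B, C])
    (I : Pt) (hI : I = incenterPt A B C)
    (D E F : Pt)
    (hD₁ : D ∈ line[ℝ, B, C]) (hD₂ : ⟪D - I, C - B⟫ = 0)
    (hE₁ : E ∈ line[ℝ, C, A]) (hE₂ : ⟪E - I, A - C⟫ = 0)
    (hF₁ : F ∈ line[ℝ, A, B]) (hF₂ : ⟪F - I, B - A⟫ = 0)
    (r : ℝ) (hr : r = dist I D)
    (A₁ B₁ C₁ : Pt)
    (hA₁ : A₁ = midpoint ℝ E F) (hB₁ : B₁ = midpoint ℝ F D) (hC₁ : C₁ = midpoint ℝ D E)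
    -- the Apollonius circles of ABC, as loci of distance ratios
    (sA sB sC : Sphere Pt)
    (hsA : ∀ p : Pt, p ∈ sA ↔ dist p B * dist A C = dist p C * dist A B)
    (hsB : ∀ p : Pt, p ∈ sB ↔ dist p C * dist B A = dist p A * dist B C)
    (hsC : ∀ p : Pt, p ∈ sC ↔ dist p A * dist C B = dist p B * dist C A)
    -- the Apollonius circles of A₁B₁C₁
    (sA₁ sB₁ sC₁ : Sphere Pt)
    (hsA₁ : ∀ p : Pt, p ∈ sA₁ ↔ dist p B₁ * dist A₁ C₁ = dist p C₁ * dist A₁ B₁)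
    (hsB₁ : ∀ p : Pt, p ∈ sB₁ ↔ dist p C₁ * dist B₁ A₁ = dist p A₁ * dist B₁ C₁)
    (hsC₁ : ∀ p : Pt, p ∈ sC₁ ↔ dist p A₁ * dist C₁ B₁ = dist p B₁ * dist C₁ A₁)
    -- circumcenter and symmedian point of A₁B₁C₁
    (O₁ K₁ : Pt)
    (hO₁ : dist O₁ A₁ = dist O₁ B₁ ∧ dist O₁ B₁ = dist O₁ C₁)
    (hK₁ : K₁ = bary A₁ B₁ C₁ (dist B₁ C₁ ^ 2) (dist C₁ A₁ ^ 2) (dist A₁ B₁ ^ 2)) :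
    (EuclideanGeometry.inversion I r '' {p : Pt | p ∈ sA} = {p : Pt | p ∈ sA₁} ∧
     EuclideanGeometry.inversion I r '' {p : Pt | p ∈ sB} = {p : Pt | p ∈ sB₁} ∧
     EuclideanGeometry.inversion I r '' {p : Pt | p ∈ sC} = {p : Pt | p ∈ sC₁}) ∧
    Coaxal sA₁ sB₁ sC₁ ∧ O₁ ∈ radAxis sA₁ sB₁ ∧
    radAxis sA₁ sB₁ = (line[ℝ, O₁, K₁] : Set Pt) := by
  have hAB : A ≠ B := by simpa using hABC.injective.ne (show (0 : Fin 3) ≠ 1 by decide)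
  have hBC : B ≠ C := by simpa using hABC.injective.ne (show (1 : Fin 3) ≠ 2 by decide)
  have hCA : C ≠ A := by simpa using hABC.injective.ne (show (2 : Fin 3) ≠ 0 by decide)
  have hBCA : AffineIndependent ℝ ![B, C, A] := by
    rw [affineIndependent_iff_not_collinear_set] at hABC ⊢
    rwa [Set.insert_comm, Set.pair_comm A C] at hABC
  have hCAB : AffineIndependent ℝ ![C, A, B] := by
    rw [affineIndependent_iff_not_collinear_set] at hABC ⊢
    rwa [Set.pair_comm B C, Set.insert_comm] at hABC
  have hta := sub_pos.2 (dist_lt_of_affineIndependent hABC)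
  have htb := sub_pos.2 (dist_lt_of_affineIndependent hBCA)
  have htc := sub_pos.2 (dist_lt_of_affineIndependent hCAB)
  have hI' : I = incenterPt B C A := hI.trans (incenterPt_rotate A B C).symm
  have hI'' : I = incenterPt C A B := hI'.trans (incenterPt_rotate B C A).symm
  have ha := dist_pos.2 hBC
  have hb := dist_pos.2 hCA
  have hc := dist_pos.2 hAB
  have hrE := dist_incenter_contact_sq hCA hBC hI hE₁ hE₂
  have hrF := dist_incenter_contact_sq hAB hCA hI' hF₁ hF₂
  have hrD := dist_incenter_contact_sq hBC hAB hI'' hD₁ hD₂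
  rw [← hr] at hrD
  have hr0 : r ≠ 0 := by
    have : 0 < r ^ 2 := by rw [hrD]; positivity
    exact fun h => by simp [h] at this
  have hAI : A ≠ I := by
    have : 0 < dist A I ^ 2 := by rw [dist_incenter_vertex_sq hBC hI]; positivity
    exact fun h => by simp [h] at this
  have hBI : B ≠ I := by
    have : 0 < dist B I ^ 2 := by rw [dist_incenter_vertex_sq hCA hI']; positivity
    exact fun h => by simp [h] at this
  have hCI : C ≠ I := by
    have : 0 < dist C I ^ 2 := by rw [dist_incenter_vertex_sq hAB hI'']; positivity
    exact fun h => by simp [h] at this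
  have iA : A₁ = EuclideanGeometry.inversion I r A := hA₁.trans <|
    midpoint_contact_eq_inversion hBC hCA hAB hta hI hE₁ hE₂ hF₁ hF₂ (by rw [hrD, hrE]; ring)
  have iB : B₁ = EuclideanGeometry.inversion I r B := hB₁.trans <|
    midpoint_contact_eq_inversion hCA hAB hBC htb hI' hF₁ hF₂ hD₁ hD₂ (by rw [hrD, hrF]; ring)
  have iC : C₁ = EuclideanGeometry.inversion I r C := hC₁.trans <|
    midpoint_contact_eq_inversion hAB hBC hCA htc hI'' hD₁ hD₂ hE₁ hE₂ (by rw [hr])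
  have hinj := EuclideanGeometry.inversion_injective I hr0
  have hAB₁ : A₁ ≠ B₁ := by rw [iA, iB]; exact hinj.ne hAB
  have hBC₁ : B₁ ≠ C₁ := by rw [iB, iC]; exact hinj.ne hBC
  have hCA₁ : C₁ ≠ A₁ := by rw [iC, iA]; exact hinj.ne hCA
  have pAB := dist_pos.2 hAB₁
  have pBC := dist_pos.2 hBC₁
  have pCA := dist_pos.2 hCA₁
  have hind : AffineIndependent ℝ ![A₁, B₁, C₁] := by
    refine Cospherical.affineIndependent_of_ne ⟨O₁, dist O₁ A₁, ?_⟩ hAB₁ hCA₁.symm hBC₁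
    rintro p (rfl | rfl | rfl)
    · exact dist_comm _ _
    · rw [dist_comm, hO₁.1]
    · rw [dist_comm, hO₁.1, hO₁.2]
  refine ⟨⟨inversion_image_apollonius hr0 hAI hBI hCI hAB hBC hCA iA iB iC hsA hsA₁,
    inversion_image_apollonius hr0 hBI hCI hAI hBC hCA hAB iB iC iA hsB hsB₁,
    inversion_image_apollonius hr0 hCI hAI hBI hCA hAB hBC iC iA iB hsC hsC₁⟩, ?_⟩
  rw [dist_comm A₁ C₁] at hsA₁
  rw [dist_comm B₁ A₁] at hsB₁
  rw [dist_comm C₁ B₁] at hsC₁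
  obtain ⟨nA, powA⟩ := spow_of_ratio_locus hBC₁ pCA pAB hsA₁
  obtain ⟨nB, powB⟩ := spow_of_ratio_locus hCA₁ pAB pBC hsB₁
  obtain ⟨nC, powC⟩ := spow_of_ratio_locus hAB₁ pBC pCA hsC₁
  have hloc := brocard_axis_locus hind rfl rfl rfl (by positivity) (by positivity)
    (by positivity) nA hO₁.1 hO₁.2 hK₁
  have axAB : radAxis sA₁ sB₁ = (line[ℝ, O₁, K₁] : Set Pt) := by
    rw [← hloc]
    ext p
    exact mem_radAxis_iff_of_spow nA nB (powA p) (powB p)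
  have axBC : radAxis sB₁ sC₁ = (line[ℝ, O₁, K₁] : Set Pt) := by
    rw [← hloc]
    ext p
    rw [mem_radAxis_iff_of_spow nB nC (powB p) (powC p), Set.mem_ofPred_eq, add_comm,
      ← add_assoc]
  have axAC : radAxis sA₁ sC₁ = (line[ℝ, O₁, K₁] : Set Pt) := by
    rw [← hloc]
    ext p
    rw [radAxis_comm, mem_radAxis_iff_of_spow nC nA (powC p) (powA p), Set.mem_ofPred_eq,
      add_assoc, add_comm]
  refine ⟨⟨axAB.trans axBC.symm, axBC.trans axAC.symm⟩, ?_, axAB⟩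
  rw [axAB]
  exact left_mem_affineSpan_pair ℝ O₁ K₁
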